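/- Let R = ℝ[x₁,…,xₙ], fix m ≥ 1 and natural numbers α₁,…,α_m, and let Λ be a symmetric m×m matrix with entries in R that is homogeneous of some degree D. Let f ∈ R be homogeneous with f ∈ (Σ(Λ) : R^m), and let g ∈ Σ(f) be homogeneous. Then g² ∈ (Σ(Λ) : R^m). -/

import Mathlib

open MvPolynomial

/-- `q` is a sum of squares of polynomials. -/
def IsSOS {n : ℕ} (q : MvPolynomial (Fin n) ℝ) : Prop :=
  ∃ (s : ℕ) (g : Fin s → MvPolynomial (Fin n) ℝ), q = ∑ i, (g i) ^ 2

/-- A vector `v ∈ R^m` is homogeneous of degree `k` (for the twists `α₁,…,α_m`) if its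
`i`-th coordinate is homogeneous of degree `k − αᵢ`, and zero whenever `k < αᵢ`. -/
def IsVHomog {n m : ℕ} (α : Fin m → ℕ) (k : ℕ)
    (v : Fin m → MvPolynomial (Fin n) ℝ) : Prop :=
  ∀ i, ((v i).IsHomogeneous (k - α i) ∧ (k < α i → v i = 0))

/-- A symmetric `m×m` matrix `Λ` over `R` is homogeneous of degree `D` (for the twists
`α₁,…,α_m`) if its `(i,j)` entry is homogeneous of degree `D − αᵢ − αⱼ`, and zero
whenever `D < αᵢ + αⱼ`. -/
def IsMatHomog {n m : ℕ} (α : Fin m → ℕ) (D : ℕ)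
    (Λ : Matrix (Fin m) (Fin m) (MvPolynomial (Fin n) ℝ)) : Prop :=
  ∀ i j, ((Λ i j).IsHomogeneous (D - α i - α j) ∧ (D < α i + α j → Λ i j = 0))

/-- `Σ(Λ)`: the `R`-submodule of `R^m` generated by all homogeneous vectors `v` such that
`q·Λ = v·vᵀ + w₁·w₁ᵀ + … + w_s·w_sᵀ` for some homogeneous sum of squares `q ∈ R` and
vectors `w₁,…,w_s ∈ R^m`. -/
noncomputable def SigmaMod {n m : ℕ} (α : Fin m → ℕ)
    (Λ : Matrix (Fin m) (Fin m) (MvPolynomial (Fin n) ℝ)) :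
    Submodule (MvPolynomial (Fin n) ℝ) (Fin m → MvPolynomial (Fin n) ℝ) :=
  Submodule.span _ {v | (∃ k, IsVHomog α k v) ∧
    ∃ (q : MvPolynomial (Fin n) ℝ) (dq : ℕ), IsSOS q ∧ q.IsHomogeneous dq ∧
      ∃ (s : ℕ) (w : Fin s → (Fin m → MvPolynomial (Fin n) ℝ)),
        q • Λ = Matrix.vecMulVec v v + ∑ l, Matrix.vecMulVec (w l) (w l)}

/-- `Σ(f)`: the ideal of `R = ℝ[x₁,…,xₙ]` generated by all homogeneous `v` such that
`q·f = v² + w₁² + … + w_s²` for some homogeneous sum of squares `q` and some `wᵢ ∈ R`. -/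
noncomputable def SigmaIdeal {n : ℕ} (f : MvPolynomial (Fin n) ℝ) :
    Ideal (MvPolynomial (Fin n) ℝ) :=
  Ideal.span {v | (∃ dv, v.IsHomogeneous dv) ∧
    ∃ (q : MvPolynomial (Fin n) ℝ) (dq : ℕ), IsSOS q ∧ q.IsHomogeneous dq ∧
      ∃ (s : ℕ) (w : Fin s → MvPolynomial (Fin n) ℝ), q * f = v ^ 2 + ∑ i, (w i) ^ 2}

/-- The cone of sums of matrices of the form `w·wᵀ`. -/
def sumOuterSquares {R ι : Type*} [CommRing R] : AddSubmonoid (Matrix ι ι R) :=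
  AddSubmonoid.closure (Set.range fun w : ι → R => Matrix.vecMulVec w w)

theorem mem_closure_range_iff_exists_sum {ι M : Type*} [AddCommMonoid M] (φ : ι → M) (x : M) :
    x ∈ AddSubmonoid.closure (Set.range φ) ↔
      ∃ (s : ℕ) (w : Fin s → ι), x = ∑ l, φ (w l) := by
  constructor
  · intro hx
    induction hx using AddSubmonoid.closure_induction with
    | mem x hx =>
      obtain ⟨w, rfl⟩ := hx
      exact ⟨1, fun _ => w, by simp⟩
    | zero => exact ⟨0, Fin.elim0, by simp⟩
    | add x y _ _ hx hy =>
      obtain ⟨s, w, rfl⟩ := hx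
      obtain ⟨t, z, rfl⟩ := hy
      exact ⟨s + t, Fin.append w z, by simp [Fin.sum_univ_add]⟩
  · rintro ⟨s, w, rfl⟩
    exact sum_mem fun l _ => AddSubmonoid.subset_closure ⟨w l, rfl⟩

theorem isSOS_iff_isSumSq {n : ℕ} (q : MvPolynomial (Fin n) ℝ) : IsSOS q ↔ IsSumSq q := by
  have h := mem_closure_range_iff_exists_sum (fun g : MvPolynomial (Fin n) ℝ => g ^ 2) q
  rw [IsSOS, ← h, ← AddSubmonoid.mem_sumSq, ← AddSubmonoid.closure_isSquare]
  have : (Set.range fun g : MvPolynomial (Fin n) ℝ => g ^ 2) = {x | IsSquare x} := by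
    ext x
    simp [isSquare_iff_exists_sq, eq_comm]
  rw [this]

section OuterSquares

variable {R ι : Type*} [CommRing R]

theorem vecMulVec_self_mem_sumOuterSquares (w : ι → R) :
    Matrix.vecMulVec w w ∈ (sumOuterSquares : AddSubmonoid (Matrix ι ι R)) :=
  AddSubmonoid.subset_closure ⟨w, rfl⟩

theorem smul_mem_sumOuterSquares {a : R} (ha : IsSumSq a) {M : Matrix ι ι R}
    (hM : M ∈ (sumOuterSquares : AddSubmonoid (Matrix ι ι R))) :
    a • M ∈ (sumOuterSquares : AddSubmonoid (Matrix ι ι R)) := by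
  induction hM using AddSubmonoid.closure_induction with
  | mem x hx =>
    obtain ⟨w, rfl⟩ := hx
    induction ha with
    | zero => simp [zero_mem]
    | sq_add b _ ih =>
      rw [add_smul]
      refine add_mem ?_ ih
      convert vecMulVec_self_mem_sumOuterSquares (b • w) using 1
      ext i j
      simp [Matrix.vecMulVec_apply]
      ring
  | zero => simp [zero_mem]
  | add x y _ _ hx hy =>
    rw [smul_add]
    exact add_mem hx hy

theorem isSumSq_diag_of_mem_sumOuterSquares {M : Matrix ι ι R}
    (hM : M ∈ (sumOuterSquares : AddSubmonoid (Matrix ι ι R))) (i : ι) : IsSumSq (M i i) := by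
  induction hM using AddSubmonoid.closure_induction with
  | mem x hx =>
    obtain ⟨w, rfl⟩ := hx
    exact IsSumSq.mul_self (w i)
  | zero => exact IsSumSq.zero
  | add x y _ _ hx hy => exact hx.add hy

end OuterSquares

theorem le_of_forall_mul_pow_le {c C : ℝ} (hc : 0 < c) {d e : ℕ}
    (h : ∀ t : ℝ, 1 ≤ t → c * t ^ d ≤ C * t ^ e) : d ≤ e := by
  by_contra! hlt
  obtain ⟨r, rfl⟩ := Nat.exists_eq_add_of_lt hlt
  have hC : 0 < C := by
    have := h 1 le_rfl
    simp at this
    linarith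
  set t : ℝ := C / c + 1 with ht_def
  have ht : 1 ≤ t := by
    have : 0 < C / c := by positivity
    linarith
  have h1 := h t ht
  have h2 : c * t ^ (r + 1) ≤ C := by
    have hp : 0 < t ^ e := by positivity
    refine le_of_mul_le_mul_right ?_ hp
    calc c * t ^ (r + 1) * t ^ e = c * t ^ (e + r + 1) := by ring
      _ ≤ _ := h1
  have h3 : t ≤ t ^ (r + 1) := le_self_pow₀ ht (by omega)
  have h4 : c * t = C + c := by
    rw [ht_def]
    field_simp
  nlinarith [mul_le_mul_of_nonneg_left h3 hc.le]

theorem eq_of_forall_mul_pow_le {c C : ℝ} (hc : 0 < c) {d e : ℕ}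
    (h : ∀ t : ℝ, 0 < t → c * t ^ d ≤ C * t ^ e) : d = e := by
  refine le_antisymm (le_of_forall_mul_pow_le hc fun t ht => h t (by linarith)) ?_
  refine le_of_forall_mul_pow_le (C := C) hc fun t ht => ?_
  have ht0 : 0 < t := by linarith
  have h1 := h t⁻¹ (by positivity)
  have h2 := mul_le_mul_of_nonneg_right h1 (by positivity : 0 ≤ t ^ d * t ^ e)
  rw [inv_pow, inv_pow] at h2
  field_simp at h2
  linarith

theorem IsSumSq.map_nonneg {R : Type*} [CommRing R] {a : R} (ha : IsSumSq a) (φ : R →+* ℝ) :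
    0 ≤ φ a := by
  induction ha with
  | zero => simp
  | sq_add b _ ih =>
    rw [map_add, map_mul]
    exact add_nonneg (mul_self_nonneg _) ih

theorem MvPolynomial.IsHomogeneous.eval_smul_point {n d : ℕ} {p : MvPolynomial (Fin n) ℝ}
    (hp : p.IsHomogeneous d) (t : ℝ) (x : Fin n → ℝ) :
    eval (fun i => t * x i) p = t ^ d * eval x p := by
  rw [eval_eq, eval_eq, Finset.mul_sum]
  refine Finset.sum_congr rfl fun s hs => ?_
  have hd : ∑ i ∈ s.support, s i = d := by
    have := hp (mem_support_iff.mp hs)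
    rwa [Finsupp.weight_apply, Finsupp.sum, Finset.sum_congr rfl (g := fun i => s i)
      (fun i _ => by simp)] at this
  simp_rw [mul_pow, Finset.prod_mul_distrib]
  rw [Finset.prod_pow_eq_pow_sum, hd]
  ring

/-- If `p` is homogeneous and dominates the square of a nonzero homogeneous `v` up to a
sum of squares, then `p` has twice the degree of `v`. -/
theorem degree_eq_of_isSumSq_sub {n d e : ℕ} {p v : MvPolynomial (Fin n) ℝ}
    (hp : p.IsHomogeneous e) (hv : v.IsHomogeneous d) (hv0 : v ≠ 0)
    (h : IsSumSq (p - v * v)) : 2 * d = e ∧ p ≠ 0 := by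
  obtain ⟨x, hx⟩ : ∃ x, eval x v ≠ 0 := by
    by_contra! hx
    exact hv0 (MvPolynomial.funext fun x => by simp [hx x])
  have key (t : ℝ) : (eval x v) ^ 2 * t ^ (2 * d) ≤ eval x p * t ^ e := by
    have := h.map_nonneg (eval fun i => t * x i)
    rw [map_sub, map_mul, hp.eval_smul_point, hv.eval_smul_point] at this
    have h2 : t ^ (2 * d) = t ^ d * t ^ d := by ring
    rw [h2]
    linarith
  have hpos : 0 < (eval x v) ^ 2 := by positivity
  refine ⟨eq_of_forall_mul_pow_le hpos fun t _ => key t, ?_⟩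
  rintro rfl
  have := key 1
  simp at this
  exact hx this

section Certificates

variable {n m : ℕ} (α : Fin m → ℕ) (D : ℕ)
  (Λ : Matrix (Fin m) (Fin m) (MvPolynomial (Fin n) ℝ))

/-- The homogeneous vectors `v` of degree `k` such that `q·Λ - v·vᵀ` is a sum of matrices
`w·wᵀ`, for some sum of squares `q` that is homogeneous of degree `2k - D`. -/
def certifiedVectors (k : ℕ) : AddSubmonoid (Fin m → MvPolynomial (Fin n) ℝ) where
  carrier := {v | IsVHomog α k v ∧ ∃ q : MvPolynomial (Fin n) ℝ, IsSumSq q ∧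
    q.IsHomogeneous (2 * k - D) ∧ (2 * k < D → q = 0) ∧
    q • Λ - Matrix.vecMulVec v v ∈
      (sumOuterSquares : AddSubmonoid (Matrix (Fin m) (Fin m) (MvPolynomial (Fin n) ℝ)))}
  zero_mem' := ⟨fun _ => ⟨isHomogeneous_zero _ _ _, fun _ => rfl⟩, 0, IsSumSq.zero,
    isHomogeneous_zero _ _ _, fun _ => rfl, by simp [zero_mem]⟩
  add_mem' := by
    rintro v w ⟨hv, q, hq, hqd, hq0, hqv⟩ ⟨hw, r, hr, hrd, hr0, hrw⟩
    refine ⟨fun i => ⟨(hv i).1.add (hw i).1, fun h => ?_⟩, (q + r) + (q + r),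
      (hq.add hr).add (hq.add hr), (hqd.add hrd).add (hqd.add hrd), fun h => ?_, ?_⟩
    · simp [(hv i).2 h, (hw i).2 h]
    · simp [hq0 h, hr0 h]
    · convert add_mem (add_mem (add_mem hqv hrw) (add_mem hqv hrw))
        (vecMulVec_self_mem_sumOuterSquares (v - w)) using 1
      ext1 i j
      simp [Matrix.vecMulVec_apply]
      ring

variable {α D Λ}

theorem smul_mem_certifiedVectors {k d : ℕ} {a : MvPolynomial (Fin n) ℝ}
    (ha : a.IsHomogeneous d) {v : Fin m → MvPolynomial (Fin n) ℝ}
    (hv : v ∈ certifiedVectors α D Λ k) : a • v ∈ certifiedVectors α D Λ (d + k) := by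
  obtain ⟨hv, q, hq, hqd, hq0, hqv⟩ := hv
  refine ⟨fun i => ⟨?_, fun h => ?_⟩, a * a * q, (IsSumSq.mul_self a).mul hq, ?_, fun h => ?_, ?_⟩
  · by_cases h : k < α i
    · simpa [(hv i).2 h] using isHomogeneous_zero _ _ _
    · rw [Nat.add_sub_assoc (by omega)]
      exact ha.mul (hv i).1
  · simp [(hv i).2 (by omega)]
  · by_cases h : 2 * k < D
    · simpa [hq0 h] using isHomogeneous_zero _ _ _
    · have : 2 * (d + k) - D = d + d + (2 * k - D) := by omega
      rw [this]
      exact (ha.mul ha).mul hqd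
  · simp [hq0 (by omega)]
  · convert smul_mem_sumOuterSquares (IsSumSq.mul_self a) hqv using 1
    ext1 i j
    simp [Matrix.vecMulVec_apply]
    ring

theorem smul_mem_iSup_certifiedVectors (a : MvPolynomial (Fin n) ℝ)
    {v : Fin m → MvPolynomial (Fin n) ℝ} (hv : v ∈ ⨆ k, certifiedVectors α D Λ k) :
    a • v ∈ ⨆ k, certifiedVectors α D Λ k := by
  induction hv using AddSubmonoid.iSup_induction' with
  | mem k v hv =>
    rw [← sum_homogeneousComponent a, Finset.sum_smul]
    exact sum_mem fun d _ => AddSubmonoid.mem_iSup_of_mem (d + k)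
      (smul_mem_certifiedVectors (homogeneousComponent_isHomogeneous d a) hv)
  | zero => simp [zero_mem]
  | add v w _ _ hv hw =>
    rw [smul_add]
    exact add_mem hv hw

theorem mem_certifiedVectors_of_certificate (hΛ : IsMatHomog α D Λ) {k dq : ℕ}
    {v : Fin m → MvPolynomial (Fin n) ℝ} (hv : IsVHomog α k v)
    {q : MvPolynomial (Fin n) ℝ} (hq : IsSumSq q) (hqd : q.IsHomogeneous dq)
    (h : q • Λ - Matrix.vecMulVec v v ∈
      (sumOuterSquares : AddSubmonoid (Matrix (Fin m) (Fin m) (MvPolynomial (Fin n) ℝ)))) :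
    v ∈ certifiedVectors α D Λ k := by
  by_cases hv0 : v = 0
  · rw [hv0]
    exact zero_mem _
  obtain ⟨i, hi⟩ := Function.ne_iff.mp hv0
  obtain ⟨hdeg, hne⟩ := degree_eq_of_isSumSq_sub (hqd.mul (hΛ i i).1) (hv i).1 hi
    (by simpa [Matrix.vecMulVec_apply] using isSumSq_diag_of_mem_sumOuterSquares h i)
  have h1 : ¬ D < α i + α i := fun h => hne (by simp [(hΛ i i).2 h])
  have h2 : ¬ k < α i := fun h => hi ((hv i).2 h)
  have h3 : 2 * k - D = dq := by omega
  exact ⟨hv, q, hq, h3 ▸ hqd, fun _ => by omega, h⟩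

theorem sigmaMod_subset_iSup_certifiedVectors (hΛ : IsMatHomog α D Λ)
    {u : Fin m → MvPolynomial (Fin n) ℝ} (hu : u ∈ SigmaMod α Λ) :
    u ∈ ⨆ k, certifiedVectors α D Λ k := by
  induction hu using Submodule.span_induction with
  | mem v hv =>
    obtain ⟨⟨k, hk⟩, q, dq, hq, hqd, s, w, hw⟩ := hv
    refine AddSubmonoid.mem_iSup_of_mem k
      (mem_certifiedVectors_of_certificate hΛ hk ((isSOS_iff_isSumSq q).mp hq) hqd ?_)
    rw [hw, add_sub_cancel_left]
    exact sum_mem fun l _ => vecMulVec_self_mem_sumOuterSquares (w l)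
  | zero => exact zero_mem _
  | add v w _ _ hv hw => exact add_mem hv hw
  | smul a v _ hv => exact smul_mem_iSup_certifiedVectors a hv

/-- The component of degree `k` of a vector, for the twists `α`. -/
noncomputable def twistedComponent (α : Fin m → ℕ) (k : ℕ) :
    (Fin m → MvPolynomial (Fin n) ℝ) →+ (Fin m → MvPolynomial (Fin n) ℝ) where
  toFun u i := if k < α i then 0 else homogeneousComponent (k - α i) (u i)
  map_zero' := by
    ext1 i
    simp
  map_add' u v := by
    ext1 i
    by_cases h : k < α i <;> simp [h]

theorem twistedComponent_of_isVHomog {k l : ℕ} {v : Fin m → MvPolynomial (Fin n) ℝ}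
    (hv : IsVHomog α l v) : twistedComponent α k v = if k = l then v else 0 := by
  ext1 i
  change (if k < α i then 0 else homogeneousComponent (k - α i) (v i)) = _
  by_cases hl : l < α i
  · split_ifs <;> simp [(hv i).2 hl]
  · rw [homogeneousComponent_of_mem (hv i).1]
    split_ifs <;> first | rfl | omega

/-- The homogeneous elements of `Σ(Λ)` are its homogeneous generators. -/
theorem mem_certifiedVectors_of_mem_sigmaMod (hΛ : IsMatHomog α D Λ) {k : ℕ}
    {u : Fin m → MvPolynomial (Fin n) ℝ} (hu : u ∈ SigmaMod α Λ) (hk : IsVHomog α k u) :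
    u ∈ certifiedVectors α D Λ k := by
  have h : (⨆ l, certifiedVectors α D Λ l) ≤
      (certifiedVectors α D Λ k).comap (twistedComponent α k) := by
    refine iSup_le fun l v hv => ?_
    rw [AddSubmonoid.mem_comap, twistedComponent_of_isVHomog hv.1]
    split_ifs with hkl
    · exact hkl ▸ hv
    · exact zero_mem _
  simpa [twistedComponent_of_isVHomog hk] using
    h (sigmaMod_subset_iSup_certifiedVectors hΛ hu)

theorem isVHomog_smul_single {d : ℕ} {a : MvPolynomial (Fin n) ℝ} (ha : a.IsHomogeneous d)
    (i : Fin m) :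
    IsVHomog α (d + α i) (a • (Pi.single i 1 : Fin m → MvPolynomial (Fin n) ℝ)) := by
  intro j
  obtain rfl | hj := eq_or_ne j i
  · exact ⟨by simpa using ha, fun h => by omega⟩
  · simpa [hj] using isHomogeneous_zero _ _ _

end Certificates

theorem const_mem_sigmaMod_of_mem_sigmaIdeal {n : ℕ} {f g : MvPolynomial (Fin n) ℝ}
    (hg : g ∈ SigmaIdeal f) :
    (fun _ => g) ∈ SigmaMod (fun _ : Fin 1 => 0) (Matrix.of fun _ _ => f) := by
  induction hg using Submodule.span_induction with
  | mem v hv =>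
    obtain ⟨⟨d, hd⟩, q, dq, hq, hqd, s, w, hw⟩ := hv
    refine Submodule.subset_span ⟨⟨d, fun _ => ⟨hd, fun h => absurd h (Nat.not_lt_zero _)⟩⟩, q, dq, hq, hqd, s,
      fun l _ => w l, ?_⟩
    ext1 i j
    simp [Matrix.sum_apply, Matrix.vecMulVec_apply, hw, sq]
  | zero => exact zero_mem _
  | add v w _ _ hv hw => exact add_mem hv hw
  | smul a v _ hv => exact Submodule.smul_mem _ a hv

/-- A homogeneous element of `Σ(f)` satisfies the condition on the generators of `Σ(f)`. -/
theorem exists_isSumSq_sub_of_mem_sigmaIdeal {n df dg : ℕ} {f g : MvPolynomial (Fin n) ℝ}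
    (hf : f.IsHomogeneous df) (hg : g.IsHomogeneous dg) (hgf : g ∈ SigmaIdeal f) :
    ∃ (q : MvPolynomial (Fin n) ℝ) (dq : ℕ), q.IsHomogeneous dq ∧ IsSumSq (q * f - g * g) := by
  obtain ⟨-, q, -, hqd, -, h⟩ := mem_certifiedVectors_of_mem_sigmaMod (D := df) (k := dg)
    (fun _ _ => ⟨by simpa using hf, fun h => by omega⟩)
    (const_mem_sigmaMod_of_mem_sigmaIdeal hgf) (fun _ => ⟨hg, fun h => by omega⟩)
  exact ⟨q, _, hqd, by
    simpa [Matrix.vecMulVec_apply] using isSumSq_diag_of_mem_sumOuterSquares h 0⟩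

/-- **Corollary.** Let `Λ` be a symmetric homogeneous `m×m` matrix over `R = ℝ[x₁,…,xₙ]`,
let `f ∈ R` be homogeneous with `f ∈ (Σ(Λ) : R^m)` and let `g ∈ Σ(f)` be homogeneous.
Then `g² ∈ (Σ(Λ) : R^m)`. -/
theorem statement11 {n m : ℕ} (hm : 1 ≤ m) (α : Fin m → ℕ) (D : ℕ)
    (Λ : Matrix (Fin m) (Fin m) (MvPolynomial (Fin n) ℝ)) (hsymm : Λ.IsSymm)
    (hΛ : IsMatHomog α D Λ) (f g : MvPolynomial (Fin n) ℝ) (df dg : ℕ)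
    (hf : f.IsHomogeneous df) (hg : g.IsHomogeneous dg) (hgf : g ∈ SigmaIdeal f)
    (hfcolon : ∀ u : Fin m → MvPolynomial (Fin n) ℝ, f • u ∈ SigmaMod α Λ) :
    ∀ u : Fin m → MvPolynomial (Fin n) ℝ, g ^ 2 • u ∈ SigmaMod α Λ := by
  obtain ⟨q, dq, hqd, hq⟩ := exists_isSumSq_sub_of_mem_sigmaIdeal hf hg hgf
  have hsingle (i : Fin m) : g ^ 2 • (Pi.single i 1 : Fin m → MvPolynomial (Fin n) ℝ) ∈
      SigmaMod α Λ := by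
    obtain ⟨-, r, hr, hrd, -, h⟩ := mem_certifiedVectors_of_mem_sigmaMod hΛ
      (hfcolon (Pi.single i 1)) (isVHomog_smul_single hf i)
    have hcert : (q * q * r) • Λ - Matrix.vecMulVec (g ^ 2 • Pi.single i 1)
        (g ^ 2 • Pi.single i 1) ∈
        (sumOuterSquares : AddSubmonoid (Matrix (Fin m) (Fin m) (MvPolynomial (Fin n) ℝ))) := by
      have hdiff : IsSumSq (q * q * (f * f) - g ^ 4) := by
        have hgq := (IsSumSq.mul_self g).mul hq
        have heq : q * q * (f * f) - g ^ 4 = (q * f - g * g) * (q * f - g * g) +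
            (g * g * (q * f - g * g) + g * g * (q * f - g * g)) := by ring
        rw [heq]
        exact (IsSumSq.mul_self _).add (hgq.add hgq)
      convert add_mem (smul_mem_sumOuterSquares (IsSumSq.mul_self q) h)
        (smul_mem_sumOuterSquares hdiff (vecMulVec_self_mem_sumOuterSquares (Pi.single i 1)))
        using 1
      ext1 j l
      simp only [Matrix.add_apply, Matrix.sub_apply, Matrix.smul_apply, Matrix.vecMulVec_apply,
        Pi.smul_apply, smul_eq_mul]
      ring
    obtain ⟨s, w, hw⟩ := (mem_closure_range_iff_exists_sum _ _).mp hcert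
    exact Submodule.subset_span ⟨⟨_, isVHomog_smul_single (hg.pow 2) i⟩, q * q * r, _,
      (isSOS_iff_isSumSq _).mpr ((IsSumSq.mul_self q).mul hr), (hqd.mul hqd).mul hrd, s, w,
      by rw [← hw]; abel⟩
  intro u
  rw [pi_eq_sum_univ' u, Finset.smul_sum]
  refine sum_mem fun i _ => ?_
  rw [smul_comm]
  have hi : (fun j => if j = i then 1 else 0) =
      (Pi.single i 1 : Fin m → MvPolynomial (Fin n) ℝ) := by
    ext1 j
    rw [Pi.single_apply]
  exact Submodule.smul_mem _ _ (hi ▸ hsingle i)
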